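/- (Discrete fractional Grönwall inequality.) Let 0 < α < 1, let 0 = t_0 < t_1 < ⋯ < t_N ≤ T be a partition with nondecreasing step sizes τ_{n−1} ≤ τ_n, let a^{(n)}_{n−k} be the nonuniform L1 weights and P^{(n)}_{n−k} the complementary discrete convolution kernels, and write D_N^{α} w^n = Σ_{k=1}^{n} a^{(n)}_{n−k} (w^k − w^{k−1}). Let {λ_l}_{l=0}^{N−1} be nonnegative with Σ_{l=0}^{N−1} λ_l ≤ λ* for a constant λ* independent of the steps, and assume τ_N ≤ (2 Γ(2−α) λ*)^{−1/α}. If the nonnegative grid function {v^n}_{n≥0} satisfies D_N^{α}((v^n)²) ≤ Σ_{l=1}^{n} λ_{n−l} (v^l)² + v^n (ξ^n + ϑ^n) for 1 ≤ n ≤ N, with nonnegative sequences {ξ^n}, {ϑ^n}, then for every 1 ≤ n ≤ N, v^n ≤ 2 E_α(2 λ* t_n^{α}) ( v^0 + max_{1≤j≤n} Σ_{l=1}^{j} P^{(j)}_{j−l} ξ^l + β_{1+α}(t_n) max_{1≤j≤n} ϑ^j ), where E_α(z) = Σ_{k=0}^{∞} z^k/Γ(1+kα) is the Mittag-Leffler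 function and β_ν(t) = t^{ν−1}/Γ(ν). -/

import Mathlib

/-- `β_ν(t) = t^(ν-1)/Γ(ν)`. -/
noncomputable def betaK (ν t : ℝ) : ℝ := t ^ (ν - 1) / Real.Gamma ν

/-- The Mittag-Leffler function `E_α(z) = Σ_{k≥0} z^k / Γ(1+kα)`. -/
noncomputable def mittagLeffler (α z : ℝ) : ℝ := ∑' k : ℕ, z ^ k / Real.Gamma (1 + k * α)

section Auxiliary

open MeasureTheory Filter

lemma betaK_nonneg {ν x : ℝ} (hν : 0 < ν) (hx : 0 ≤ x) : 0 ≤ betaK ν x :=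
  div_nonneg (Real.rpow_nonneg hx _) (Real.Gamma_pos_of_pos hν).le

lemma betaK_pos {ν x : ℝ} (hν : 0 < ν) (hx : 0 < x) : 0 < betaK ν x :=
  div_pos (Real.rpow_pos_of_pos hx _) (Real.Gamma_pos_of_pos hν)

lemma betaK_zero {ν : ℝ} (hν : 1 < ν) : betaK ν 0 = 0 := by
  rw [betaK, Real.zero_rpow (by linarith), zero_div]

lemma betaK_one (x : ℝ) : betaK 1 x = 1 := by simp [betaK]

lemma betaK_le_betaK {ν x y : ℝ} (hν : 1 ≤ ν) (hx : 0 ≤ x) (hxy : x ≤ y) :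
    betaK ν x ≤ betaK ν y :=
  div_le_div_of_nonneg_right (Real.rpow_le_rpow hx hxy (by linarith))
    (Real.Gamma_pos_of_pos (by linarith)).le

lemma betaK_anti {ν x y : ℝ} (hν : 0 < ν) (hν1 : ν ≤ 1) (hx : 0 < x) (hxy : x ≤ y) :
    betaK ν y ≤ betaK ν x :=
  div_le_div_of_nonneg_right (Real.rpow_le_rpow_of_nonpos hx hxy (by linarith))
    (Real.Gamma_pos_of_pos hν).le

lemma continuous_betaK_add_one {ν : ℝ} (hν : 0 < ν) : Continuous (betaK (ν + 1)) := by
  unfold betaK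
  exact (Real.continuous_rpow_const (by linarith)).div_const _

lemma hasDerivAt_betaK_add_one {ν x : ℝ} (hν : 0 < ν) (hx : 0 < x) :
    HasDerivAt (betaK (ν + 1)) (betaK ν x) x := by
  have h := (Real.hasDerivAt_rpow_const (p := ν) (Or.inl hx.ne')).div_const (Real.Gamma (ν + 1))
  have e : betaK (ν + 1) = fun x => x ^ ν / Real.Gamma (ν + 1) := by
    funext y; simp [betaK]
  have e' : betaK ν x = ν * x ^ (ν - 1) / Real.Gamma (ν + 1) := by
    rw [Real.Gamma_add_one hν.ne', betaK, mul_div_mul_left _ _ hν.ne']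
  rw [e, e']
  exact h

lemma intervalIntegrable_betaK {ν : ℝ} (hν : 0 < ν) (c d : ℝ) :
    IntervalIntegrable (betaK ν) volume c d := by
  unfold betaK
  exact (intervalIntegral.intervalIntegrable_rpow' (by linarith)).div_const _

lemma integral_betaK {ν c d : ℝ} (hν : 0 < ν) (hc : 0 ≤ c) (hcd : c ≤ d) :
    ∫ s in c..d, betaK ν s = betaK (ν + 1) d - betaK (ν + 1) c :=
  intervalIntegral.integral_eq_sub_of_hasDerivAt_of_le hcd
    (continuous_betaK_add_one hν).continuousOn
    (fun _ hx => hasDerivAt_betaK_add_one hν (hc.trans_lt hx.1)) (intervalIntegrable_betaK hν c d)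

lemma integral_betaK_mul_betaK {p q x : ℝ} (hp : 0 < p) (hq : 0 < q) (hx : 0 < x) :
    ∫ s in (0 : ℝ)..x, betaK p (x - s) * betaK q s = betaK (p + q) x := by
  have h := Complex.betaIntegral_scaled q p hx
  rw [Complex.betaIntegral_eq_Gamma_mul_div _ _ (by simpa) (by simpa)] at h
  have e : ∫ s in (0 : ℝ)..x, (s : ℂ) ^ ((q : ℂ) - 1) * ((x : ℂ) - s) ^ ((p : ℂ) - 1) =
      ((∫ s in (0 : ℝ)..x, s ^ (q - 1) * (x - s) ^ (p - 1) : ℝ) : ℂ) := by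
    rw [← intervalIntegral.integral_ofReal]
    refine intervalIntegral.integral_congr fun s hs => ?_
    rw [Set.uIcc_of_le hx.le] at hs
    have h1 : 0 ≤ x - s := by linarith [hs.2]
    push_cast [Complex.ofReal_cpow hs.1, Complex.ofReal_cpow h1]
    rfl
  rw [e, ← Complex.ofReal_add, Complex.Gamma_ofReal, Complex.Gamma_ofReal, Complex.Gamma_ofReal,
    ← Complex.ofReal_one, ← Complex.ofReal_sub, ← Complex.ofReal_cpow hx.le] at h
  norm_cast at h
  have hp' := (Real.Gamma_pos_of_pos hp).ne'
  have hq' := (Real.Gamma_pos_of_pos hq).ne'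
  have e2 : ∀ s : ℝ, betaK p (x - s) * betaK q s =
      (s ^ (q - 1) * (x - s) ^ (p - 1)) / (Real.Gamma p * Real.Gamma q) := by
    intro s
    simp only [betaK]
    field_simp
  simp only [e2]
  rw [intervalIntegral.integral_div, h, betaK, add_comm q p]
  field_simp

lemma intervalIntegrable_betaK_mul_betaK {p q x c d : ℝ} (hp : 0 < p) (hq : 0 < q)
    (hc : 0 ≤ c) (hcd : c ≤ d) (hd : d ≤ x) :
    IntervalIntegrable (fun s => betaK p (x - s) * betaK q s) volume c d := by
  rcases (hc.trans (hcd.trans hd)).eq_or_lt with h0 | hx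
  · have : c = d := by linarith
    rw [this]
  have h : IntervalIntegrable (fun s => betaK p (x - s) * betaK q s) volume 0 x := by
    by_contra h
    have := integral_betaK_mul_betaK hp hq hx
    rw [intervalIntegral.integral_undef h] at this
    exact (betaK_pos (add_pos hp hq) hx).ne this
  refine h.mono_set ?_
  rw [Set.uIcc_of_le hcd, Set.uIcc_of_le hx.le]
  exact Set.Icc_subset_Icc hc hd

lemma intervalIntegrable_betaK_sub_left {p : ℝ} (hp : 0 < p) (x c d : ℝ) :
    IntervalIntegrable (fun s => betaK p (x - s)) volume c d := by
  simpa using (intervalIntegrable_betaK hp (x - c) (x - d)).comp_sub_left x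

lemma integral_betaK_sub_left {p x c d : ℝ} (hp : 0 < p) (hcd : c ≤ d) (hd : d ≤ x) :
    ∫ s in c..d, betaK p (x - s) = betaK (p + 1) (x - c) - betaK (p + 1) (x - d) := by
  rw [intervalIntegral.integral_comp_sub_left (fun s => betaK p s) x]
  exact integral_betaK hp (by linarith) (by linarith)

/-- Chebyshev-type comparison of the convolution integrand with an averaged kernel, in the case
where `β_{q+1}` is concave. -/
lemma integral_betaK_mul_betaK_le_of_le_one {p q x c d : ℝ} (hp : 0 < p) (hp1 : p ≤ 1)
    (hq : 0 < q) (hq1 : q ≤ 1) (hc : 0 ≤ c) (hcd : c < d) (hd : d ≤ x) :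
    ∫ s in c..d, betaK p (x - s) * betaK q s ≤
      (betaK (p + 1) (x - c) - betaK (p + 1) (x - d)) / (d - c) *
        (betaK (q + 1) d - betaK (q + 1) c) := by
  obtain ⟨s₀, hs₀, hslope⟩ := exists_hasDerivAt_eq_slope (betaK (q + 1)) (betaK q) hcd
    (continuous_betaK_add_one hq).continuousOn
    (fun y hy => hasDerivAt_betaK_add_one hq (hc.trans_lt hy.1))
  have hfi := intervalIntegrable_betaK_sub_left hp x c d
  have hgi := intervalIntegrable_betaK hq c d
  have hfgi := intervalIntegrable_betaK_mul_betaK hp hq hc hcd.le hd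
  have hf := integral_betaK_sub_left hp hcd.le hd
  have hg := integral_betaK hq hc hcd.le
  have hpt : ∀ s ∈ Set.Ioo c d, betaK p (x - s) * betaK q s ≤
      betaK p (x - s₀) * betaK q s +
        (betaK q s₀ * betaK p (x - s) - betaK p (x - s₀) * betaK q s₀) := by
    intro s hs
    have hs0 : 0 < s := hc.trans_lt hs.1
    have hs₀0 : 0 < s₀ := hc.trans_lt hs₀.1
    have hxs : 0 < x - s := by linarith [hs.2]
    have hxs₀ : 0 < x - s₀ := by linarith [hs₀.2]
    rcases le_total s s₀ with h | h
    · nlinarith [mul_nonneg (sub_nonneg.2 (betaK_anti hq hq1 hs0 h))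
        (sub_nonneg.2 (betaK_anti hp hp1 hxs₀ (by linarith : x - s₀ ≤ x - s)))]
    · nlinarith [mul_nonneg (sub_nonneg.2 (betaK_anti hq hq1 hs₀0 h))
        (sub_nonneg.2 (betaK_anti hp hp1 hxs (by linarith : x - s ≤ x - s₀)))]
  have hle := intervalIntegral.integral_mono_on_of_le_Ioo hcd.le hfgi
    ((hgi.const_mul (betaK p (x - s₀))).add
      ((hfi.const_mul (betaK q s₀)).sub intervalIntegrable_const)) hpt
  refine hle.trans_eq ?_
  rw [intervalIntegral.integral_add (hgi.const_mul _)
      ((hfi.const_mul _).sub intervalIntegrable_const),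
    intervalIntegral.integral_sub (hfi.const_mul _) intervalIntegrable_const,
    intervalIntegral.integral_const_mul, intervalIntegral.integral_const_mul,
    intervalIntegral.integral_const, hf, hg, hslope, smul_eq_mul]
  have : d - c ≠ 0 := by linarith
  field_simp
  ring

lemma integral_betaK_mul_betaK_le_of_one_le {p q x c d : ℝ} (hp : 0 < p)
    (hq1 : 1 ≤ q) (hc : 0 ≤ c) (hcd : c ≤ d) (hd : d ≤ x) :
    ∫ s in c..d, betaK p (x - s) * betaK q s ≤
      (betaK (p + 1) (x - c) - betaK (p + 1) (x - d)) * betaK q d := by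
  have hq : 0 < q := by linarith
  rw [← integral_betaK_sub_left hp hcd hd, ← intervalIntegral.integral_mul_const]
  refine intervalIntegral.integral_mono_on_of_le_Ioo hcd
    (intervalIntegrable_betaK_mul_betaK hp hq hc hcd hd)
    ((intervalIntegrable_betaK_sub_left hp x c d).mul_const _) fun s hs => ?_
  exact mul_le_mul_of_nonneg_left (betaK_le_betaK hq1 (hc.trans hs.1.le) hs.2.le)
    (betaK_nonneg hp (by linarith [hs.2]))

lemma mul_betaK_le_betaK_add_one_sub {q c d : ℝ} (hq1 : 1 ≤ q) (hc : 0 ≤ c) (hcd : c ≤ d) :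
    (d - c) * betaK q c ≤ betaK (q + 1) d - betaK (q + 1) c := by
  have hq : 0 < q := by linarith
  rw [← integral_betaK hq hc hcd, ← smul_eq_mul, ← intervalIntegral.integral_const]
  exact intervalIntegral.integral_mono_on hcd intervalIntegrable_const
    (intervalIntegrable_betaK hq c d) fun s hs => betaK_le_betaK hq1 hc hs.1

lemma betaK_lt_betaK {ν x y : ℝ} (hν : 1 < ν) (hx : 0 ≤ x) (hxy : x < y) :
    betaK ν x < betaK ν y :=
  div_lt_div_of_pos_right (Real.rpow_lt_rpow hx hxy (by linarith))
    (Real.Gamma_pos_of_pos (by linarith))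

lemma concaveOn_betaK {ν : ℝ} (hν : 1 ≤ ν) (hν2 : ν ≤ 2) :
    ConcaveOn ℝ (Set.Ici 0) (betaK ν) := by
  have h := (Real.concaveOn_rpow (p := ν - 1) (by linarith) (by linarith)).smul
    (inv_nonneg.2 (Real.Gamma_pos_of_pos (by linarith : 0 < ν)).le)
  have e : betaK ν = fun x => (Real.Gamma ν)⁻¹ • x ^ (ν - 1) := by
    funext x
    simp [betaK, div_eq_inv_mul]
  rw [e]
  exact h

lemma rpow_mul_Gamma_le {x α : ℝ} (hx : 1 < x) (hα : 0 < α) :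
    (x - 1) ^ α * Real.Gamma x ≤ Real.Gamma (x + α) := by
  have hG : 0 < Real.Gamma (x - 1) := Real.Gamma_pos_of_pos (by linarith)
  have hGx : 0 < Real.Gamma x := Real.Gamma_pos_of_pos (by linarith)
  have hGxα : 0 < Real.Gamma (x + α) := Real.Gamma_pos_of_pos (by linarith)
  have h := Real.convexOn_log_Gamma.slope_mono_adjacent (x := x - 1) (y := x) (z := x + α)
    (Set.mem_Ioi.2 (by linarith)) (Set.mem_Ioi.2 (by linarith)) (by linarith) (by linarith)
  have e : Real.Gamma x = (x - 1) * Real.Gamma (x - 1) := by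
    rw [← Real.Gamma_add_one (by linarith), sub_add_cancel]
  simp only [Function.comp] at h
  have e' : Real.log (Real.Gamma x) - Real.log (Real.Gamma (x - 1)) = Real.log (x - 1) := by
    rw [e, Real.log_mul (by linarith) hG.ne']; ring
  rw [e', sub_sub_cancel, div_one, add_sub_cancel_left, le_div_iff₀ hα] at h
  rw [← Real.log_le_log_iff (by have : 0 < x - 1 := by linarith
                                positivity) hGxα,
    Real.log_mul (Real.rpow_pos_of_pos (by linarith) _).ne' hGx.ne',
    Real.log_rpow (by linarith)]
  linarith

lemma summable_mittagLeffler {α : ℝ} (hα : 0 < α) (z : ℝ) :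
    Summable fun k : ℕ => z ^ k / Real.Gamma (1 + k * α) := by
  refine summable_of_ratio_norm_eventually_le (r := 1 / 2) (by norm_num) ?_
  have ht : Tendsto (fun k : ℕ => ((k : ℝ) * α) ^ α) atTop atTop :=
    (tendsto_rpow_atTop hα).comp (tendsto_natCast_atTop_atTop.atTop_mul_const hα)
  filter_upwards [ht.eventually_ge_atTop (2 * |z|), eventually_ge_atTop 1] with k hk hk1
  have hkα : 0 < (k : ℝ) * α := by
    have : (1 : ℝ) ≤ k := by exact_mod_cast hk1
    positivity
  have hG := rpow_mul_Gamma_le (x := 1 + k * α) (by linarith) hα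
  rw [add_sub_cancel_left] at hG
  have h1 : 0 < Real.Gamma (1 + k * α) := Real.Gamma_pos_of_pos (by linarith)
  have e : (1 + ((k + 1 : ℕ) : ℝ) * α) = 1 + k * α + α := by push_cast; ring
  have h2 : 0 < Real.Gamma (1 + k * α + α) := Real.Gamma_pos_of_pos (by linarith)
  rw [e, norm_div, norm_div, Real.norm_of_nonneg h1.le, Real.norm_of_nonneg h2.le, norm_pow,
    norm_pow, Real.norm_eq_abs, div_le_iff₀ h2, pow_succ]
  have h3 : 2 * |z| * Real.Gamma (1 + k * α) ≤ Real.Gamma (1 + k * α + α) :=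
    (mul_le_mul_of_nonneg_right hk h1.le).trans hG
  calc |z| ^ k * |z| = 1 / 2 * (|z| ^ k / Real.Gamma (1 + k * α)) *
        (2 * |z| * Real.Gamma (1 + k * α)) := by field_simp
    _ ≤ _ := mul_le_mul_of_nonneg_left h3 (by positivity)

lemma mittagLeffler_mono {α z w : ℝ} (hα : 0 < α) (hz : 0 ≤ z) (hzw : z ≤ w) :
    mittagLeffler α z ≤ mittagLeffler α w :=
  (summable_mittagLeffler hα z).tsum_le_tsum
    (fun k => div_le_div_of_nonneg_right (pow_le_pow_left₀ hz hzw k)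
      (Real.Gamma_pos_of_pos (by positivity)).le) (summable_mittagLeffler hα w)

lemma hasSum_mittagLeffler {α x : ℝ} (hα : 0 < α) (μ : ℝ) (hx : 0 ≤ x) :
    HasSum (fun m : ℕ => μ ^ m * betaK (1 + m * α) x) (mittagLeffler α (μ * x ^ α)) := by
  have h : HasSum _ (mittagLeffler α (μ * x ^ α)) :=
    (summable_mittagLeffler hα (μ * x ^ α)).hasSum
  convert h using 2 with m
  rw [betaK, add_sub_cancel_left, mul_pow, mul_comm (m : ℝ) α, Real.rpow_mul_natCast hx,
    mul_div_assoc]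

lemma hasSum_mul_mittagLeffler_sub_one {α x : ℝ} (hα : 0 < α) (μ : ℝ) (hx : 0 ≤ x) :
    HasSum (fun m : ℕ => μ ^ (m + 1) * betaK (1 + (m + 1 : ℕ) * α) x)
      (mittagLeffler α (μ * x ^ α) - 1) := by
  have h := (hasSum_nat_add_iff' 1).2 (hasSum_mittagLeffler hα μ hx)
  simpa [betaK] using h

lemma one_le_mittagLeffler {α z : ℝ} (hα : 0 < α) (hz : 0 ≤ z) : 1 ≤ mittagLeffler α z := by
  have h := (summable_mittagLeffler hα z).le_tsum 0
    (fun k _ => div_nonneg (pow_nonneg hz k) (Real.Gamma_pos_of_pos (by positivity)).le)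
  simpa [mittagLeffler] using h

/-- The nonuniform L1 weight `a^{(n)}_{n-k}`, indexed by `n` and `k`. -/
noncomputable def l1Weight (α : ℝ) (t : ℕ → ℝ) (n k : ℕ) : ℝ :=
  (betaK (2 - α) (t n - t (k - 1)) - betaK (2 - α) (t n - t k)) / (t k - t (k - 1))

section L1Weight

variable {α : ℝ} {t : ℕ → ℝ} {n k : ℕ}

lemma le_of_mesh_lt (hmono : ∀ i j : ℕ, i < j → j ≤ n → t i < t j) {i j : ℕ} (hij : i ≤ j)
    (hj : j ≤ n) : t i ≤ t j := by
  rcases hij.eq_or_lt with rfl | h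
  · exact le_rfl
  · exact (hmono i j h hj).le

lemma l1Weight_pos (hα1 : α < 1) (hmono : ∀ i j : ℕ, i < j → j ≤ n → t i < t j)
    (hk : 1 ≤ k) (hkn : k ≤ n) : 0 < l1Weight α t n k := by
  have h1 := hmono (k - 1) k (by omega) hkn
  have h2 := le_of_mesh_lt hmono hkn le_rfl
  exact div_pos (sub_pos.2 (betaK_lt_betaK (by linarith) (by linarith) (by linarith)))
    (by linarith)

lemma l1Weight_le_succ (hα0 : 0 < α) (hα1 : α < 1)
    (hmono : ∀ i j : ℕ, i < j → j ≤ n → t i < t j)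
    (hk : 1 ≤ k) (hkn : k < n) : l1Weight α t n k ≤ l1Weight α t n (k + 1) := by
  have h1 := hmono (k - 1) k (by omega) hkn.le
  have h2 := hmono k (k + 1) (by omega) hkn
  have h3 : t (k + 1) ≤ t n := le_of_mesh_lt hmono hkn le_rfl
  have h := (concaveOn_betaK (ν := 2 - α) (by linarith) (by linarith)).slope_anti_adjacent
    (x := t n - t (k + 1)) (y := t n - t k) (z := t n - t (k - 1))
    (Set.mem_Ici.2 (by linarith)) (Set.mem_Ici.2 (by linarith)) (by linarith) (by linarith)
  simpa [l1Weight] using h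

lemma one_div_l1Weight_self (hα1 : α < 1) (h : t (n - 1) < t n) :
    1 / l1Weight α t n n = Real.Gamma (2 - α) * (t n - t (n - 1)) ^ α := by
  have hτ : 0 < t n - t (n - 1) := sub_pos.2 h
  have hG := (Real.Gamma_pos_of_pos (by linarith : 0 < 2 - α)).ne'
  have e : (t n - t (n - 1)) ^ (2 - α - 1) = (t n - t (n - 1)) / (t n - t (n - 1)) ^ α := by
    rw [show 2 - α - 1 = 1 - α by ring, Real.rpow_sub hτ, Real.rpow_one]
  have hτα := (Real.rpow_pos_of_pos hτ α).ne'
  rw [l1Weight, sub_self, betaK_zero (by linarith), sub_zero, betaK, e]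
  field_simp

end L1Weight

lemma sum_Icc_one_eq_sum_range (f : ℕ → ℝ) (n : ℕ) :
    ∑ k ∈ Finset.Icc 1 n, f k = ∑ k ∈ Finset.range n, f (k + 1) := by
  induction n with
  | zero => simp
  | succ n ih => rw [Finset.sum_Icc_succ_top (by omega), ih, Finset.sum_range_succ]

/-- `Q` is the family of complementary convolution kernels (at level `n`) of the lower triangular
weights `A`. -/
structure IsComplementaryKernel (n : ℕ) (A : ℕ → ℕ → ℝ) (Q : ℕ → ℝ) : Prop where
  top : Q n = 1 / A n n
  rec_eq : ∀ k, 1 ≤ k → k < n →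
    Q k = 1 / A k k * ∑ j ∈ Finset.Icc (k + 1) n, (A j (k + 1) - A j k) * Q j

namespace IsComplementaryKernel

variable {n : ℕ} {A : ℕ → ℕ → ℝ} {Q : ℕ → ℝ}

lemma nonneg (h : IsComplementaryKernel n A Q)
    (hA : ∀ j k, 1 ≤ k → k ≤ j → j ≤ n → 0 < A j k)
    (hA' : ∀ j k, 1 ≤ k → k < j → j ≤ n → A j k ≤ A j (k + 1)) {k : ℕ} (hk : 1 ≤ k)
    (hkn : k ≤ n) : 0 ≤ Q k := by
  induction hd : n - k using Nat.strong_induction_on generalizing k with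
  | _ d ih =>
    rcases hkn.eq_or_lt with rfl | hlt
    · rw [h.top]
      exact (one_div_pos.2 (hA _ _ hk le_rfl le_rfl)).le
    · rw [h.rec_eq k hk hlt]
      refine mul_nonneg (one_div_pos.2 (hA k k hk le_rfl hkn)).le
        (Finset.sum_nonneg fun j hj => ?_)
      rw [Finset.mem_Icc] at hj
      exact mul_nonneg (sub_nonneg.2 (hA' j k hk (by omega) hj.2))
        (ih (n - j) (by omega) (by omega) hj.2 rfl)

lemma sum_mul_eq_one (h : IsComplementaryKernel n A Q)
    (hA : ∀ j k, 1 ≤ k → k ≤ j → j ≤ n → 0 < A j k) {k : ℕ} (hk : 1 ≤ k) (hkn : k ≤ n) :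
    ∑ j ∈ Finset.Icc k n, Q j * A j k = 1 := by
  induction hd : n - k using Nat.strong_induction_on generalizing k with
  | _ d ih =>
    rcases hkn.eq_or_lt with rfl | hlt
    · rw [Finset.Icc_self, Finset.sum_singleton, h.top]
      exact one_div_mul_cancel (hA _ _ hk le_rfl le_rfl).ne'
    · have hkk := (hA k k hk le_rfl hkn).ne'
      have e : Q k * A k k = ∑ j ∈ Finset.Icc (k + 1) n, (A j (k + 1) - A j k) * Q j := by
        rw [h.rec_eq k hk hlt]
        field_simp
      rw [← Finset.insert_Icc_add_one_left_eq_Icc hkn, Finset.sum_insert (by simp), e,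
        ← Finset.sum_add_distrib, ← ih (n - (k + 1)) (by omega) (by omega) hlt rfl]
      exact Finset.sum_congr rfl fun j _ => by ring

lemma sum_mul_sum (h : IsComplementaryKernel n A Q)
    (hA : ∀ j k, 1 ≤ k → k ≤ j → j ≤ n → 0 < A j k) (δ : ℕ → ℝ) :
    ∑ j ∈ Finset.Icc 1 n, Q j * ∑ k ∈ Finset.Icc 1 j, A j k * δ k =
      ∑ k ∈ Finset.Icc 1 n, δ k := by
  simp only [Finset.mul_sum]
  rw [Finset.sum_comm' (t' := Finset.Icc 1 n) (s' := fun k => Finset.Icc k n)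
    (fun j k => by simp only [Finset.mem_Icc]; omega)]
  refine Finset.sum_congr rfl fun k hk => ?_
  rw [Finset.mem_Icc] at hk
  simp only [← mul_assoc]
  rw [← Finset.sum_mul, h.sum_mul_eq_one hA hk.1 hk.2, one_mul]

end IsComplementaryKernel

section Mesh

variable {α : ℝ} {t : ℕ → ℝ} {n : ℕ} {Q : ℕ → ℝ}

lemma betaK_eq_sum_integral {p q : ℝ} (hp : 0 < p) (hq : 0 < q) (ht0 : t 0 = 0)
    (hmono : ∀ i j : ℕ, i < j → j ≤ n → t i < t j) {j : ℕ} (hj1 : 1 ≤ j) (hj : j ≤ n) :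
    betaK (p + q) (t j) =
      ∑ k ∈ Finset.Icc 1 j, ∫ s in t (k - 1)..t k, betaK p (t j - s) * betaK q s := by
  have htj : 0 < t j := ht0 ▸ hmono 0 j hj1 hj
  rw [← integral_betaK_mul_betaK hp hq htj, sum_Icc_one_eq_sum_range]
  simp only [Nat.add_sub_cancel]
  rw [intervalIntegral.sum_integral_adjacent_intervals, ht0]
  intro k hk
  have h0 : 0 ≤ t k := ht0 ▸ le_of_mesh_lt hmono (Nat.zero_le k) (by omega)
  exact intervalIntegrable_betaK_mul_betaK hp hq h0 (hmono k (k + 1) (by omega) (by omega)).le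
    (le_of_mesh_lt hmono hk hj)

lemma sum_Icc_one_sub (u : ℕ → ℝ) (n : ℕ) :
    ∑ k ∈ Finset.Icc 1 n, (u k - u (k - 1)) = u n - u 0 := by
  rw [sum_Icc_one_eq_sum_range]
  exact Finset.sum_range_sub u n

lemma sum_mul_betaK_le_of_le_one (hα0 : 0 < α) (hα1 : α < 1) (ht0 : t 0 = 0)
    (hmono : ∀ i j : ℕ, i < j → j ≤ n → t i < t j)
    (hQ : IsComplementaryKernel n (l1Weight α t) Q)
    (hQ0 : ∀ j, 1 ≤ j → j ≤ n → 0 ≤ Q j) {q : ℝ} (hq : 0 < q) (hq1 : q ≤ 1) :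
    ∑ j ∈ Finset.Icc 1 n, Q j * betaK (1 - α + q) (t j) ≤ betaK (q + 1) (t n) := by
  have hA : ∀ j k, 1 ≤ k → k ≤ j → j ≤ n → 0 < l1Weight α t j k := fun j k h1 h2 h3 =>
    l1Weight_pos hα1 (fun i i' h h' => hmono i i' h (h'.trans h3)) h1 h2
  have h := hQ.sum_mul_sum hA (fun k => betaK (q + 1) (t k) - betaK (q + 1) (t (k - 1)))
  rw [sum_Icc_one_sub (fun k => betaK (q + 1) (t k)), ht0, betaK_zero (by linarith),
    sub_zero] at h
  rw [← h]
  refine Finset.sum_le_sum fun j hj => ?_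
  rw [Finset.mem_Icc] at hj
  refine mul_le_mul_of_nonneg_left ?_ (hQ0 j hj.1 hj.2)
  rw [betaK_eq_sum_integral (by linarith) hq ht0 hmono hj.1 hj.2]
  refine Finset.sum_le_sum fun k hk => ?_
  rw [Finset.mem_Icc] at hk
  have h0 : 0 ≤ t (k - 1) := ht0 ▸ le_of_mesh_lt hmono (Nat.zero_le _) (by omega)
  have := integral_betaK_mul_betaK_le_of_le_one (p := 1 - α) (x := t j) (by linarith)
    (by linarith) hq hq1 h0 (hmono (k - 1) k (by omega) (by omega))
    (le_of_mesh_lt hmono hk.2 hj.2)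
  rwa [show 1 - α + 1 = 2 - α by ring] at this

lemma sum_mul_betaK_le_of_one_le (hα1 : α < 1) (ht0 : t 0 = 0)
    (hmono : ∀ i j : ℕ, i < j → j ≤ n → t i < t j)
    (hτ : ∀ k : ℕ, 2 ≤ k → k ≤ n → t (k - 1) - t (k - 2) ≤ t k - t (k - 1))
    (hQ : IsComplementaryKernel n (l1Weight α t) Q)
    (hQ0 : ∀ j, 1 ≤ j → j ≤ n → 0 ≤ Q j) (hn : 1 ≤ n) {q : ℝ} (hq1 : 1 ≤ q) :
    ∑ j ∈ Finset.Icc 1 (n - 1), Q j * betaK (1 - α + q) (t j) ≤ betaK (q + 1) (t n) := by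
  have hq : 0 < q := by linarith
  have hA : ∀ j k, 1 ≤ k → k ≤ j → j ≤ n → 0 < l1Weight α t j k := fun j k h1 h2 h3 =>
    l1Weight_pos hα1 (fun i i' h h' => hmono i i' h (h'.trans h3)) h1 h2
  obtain ⟨m, rfl⟩ : ∃ m, n = m + 1 := ⟨n - 1, by omega⟩
  rw [Nat.add_sub_cancel]
  set δ : ℕ → ℝ := fun k =>
    if k ≤ m then betaK (q + 1) (t (k + 1)) - betaK (q + 1) (t k) else 0 with hδ
  have ht : ∀ k, k ≤ m + 1 → 0 ≤ t k := fun k hk =>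
    ht0 ▸ le_of_mesh_lt hmono (Nat.zero_le _) hk
  have hδ0 : ∀ k, 0 ≤ δ k := by
    intro k
    simp only [hδ]
    split_ifs with h
    · exact sub_nonneg.2 (betaK_le_betaK (by linarith) (ht k (by omega))
        (hmono k (k + 1) (by omega) (by omega)).le)
    · exact le_rfl
  have hsum : ∑ k ∈ Finset.Icc 1 (m + 1), δ k ≤ betaK (q + 1) (t (m + 1)) := by
    have e : ∀ k ∈ Finset.Icc 1 m, δ k =
        betaK (q + 1) (t (k + 1)) - betaK (q + 1) (t (k - 1 + 1)) := by
      intro k hk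
      rw [Finset.mem_Icc] at hk
      simp only [hδ, if_pos hk.2, Nat.sub_add_cancel hk.1]
    rw [Finset.sum_Icc_succ_top (by omega), Finset.sum_congr rfl e,
      sum_Icc_one_sub (fun k => betaK (q + 1) (t (k + 1)))]
    have := betaK_nonneg (ν := q + 1) (by linarith) (ht 1 (by omega))
    simp [hδ, this]
  rw [← hQ.sum_mul_sum hA δ] at hsum
  refine le_trans ?_ hsum
  rw [Finset.sum_Icc_succ_top (by omega)]
  refine le_add_of_le_of_nonneg (Finset.sum_le_sum fun j hj => ?_)
    (mul_nonneg (hQ0 _ (by omega) le_rfl) (Finset.sum_nonneg fun k hk =>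
      mul_nonneg (hA _ _ (Finset.mem_Icc.1 hk).1 (Finset.mem_Icc.1 hk).2 le_rfl).le (hδ0 k)))
  rw [Finset.mem_Icc] at hj
  refine mul_le_mul_of_nonneg_left ?_ (hQ0 j hj.1 (by omega))
  rw [betaK_eq_sum_integral (by linarith) hq ht0 hmono hj.1 (by omega)]
  refine Finset.sum_le_sum fun k hk => ?_
  rw [Finset.mem_Icc] at hk
  have hkm : k ≤ m := hk.2.trans hj.2
  have hlt := hmono (k - 1) k (by omega) (by omega)
  have hA' := hA j k hk.1 hk.2 (by omega)
  have h1 := integral_betaK_mul_betaK_le_of_one_le (p := 1 - α) (x := t j) (by linarith)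
    hq1 (ht (k - 1) (by omega)) hlt.le (le_of_mesh_lt hmono hk.2 (by omega))
  have h2 : betaK (1 - α + 1) (t j - t (k - 1)) - betaK (1 - α + 1) (t j - t k) =
      l1Weight α t j k * (t k - t (k - 1)) := by
    have := (sub_pos.2 hlt).ne'
    rw [l1Weight, show 1 - α + 1 = 2 - α by ring, div_mul_cancel₀ _ this]
  rw [h2, mul_assoc] at h1
  refine h1.trans (mul_le_mul_of_nonneg_left ?_ hA'.le)
  have h3 := hτ (k + 1) (by omega) (by omega)
  rw [Nat.add_sub_cancel, show k + 1 - 2 = k - 1 by omega] at h3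
  simp only [hδ, if_pos hkm]
  exact (mul_le_mul_of_nonneg_right h3 (betaK_nonneg hq (ht k (by omega)))).trans
    (mul_betaK_le_betaK_add_one_sub hq1 (ht k (by omega)) (hmono k (k + 1) (by omega)
      (by omega)).le)

lemma sum_mul_betaK_le (hα0 : 0 < α) (hα1 : α < 1) (ht0 : t 0 = 0)
    (hmono : ∀ i j : ℕ, i < j → j ≤ n → t i < t j)
    (hτ : ∀ k : ℕ, 2 ≤ k → k ≤ n → t (k - 1) - t (k - 2) ≤ t k - t (k - 1))
    (hQ : IsComplementaryKernel n (l1Weight α t) Q)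
    (hQ0 : ∀ j, 1 ≤ j → j ≤ n → 0 ≤ Q j) (hn : 1 ≤ n) {q : ℝ} (hq : 0 < q) :
    ∑ j ∈ Finset.Icc 1 (n - 1), Q j * betaK (1 - α + q) (t j) ≤ betaK (q + 1) (t n) := by
  rcases le_total q 1 with hq1 | hq1
  · refine le_trans (Finset.sum_le_sum_of_subset_of_nonneg
      (Finset.Icc_subset_Icc_right (Nat.sub_le n 1)) fun j hj _ => ?_)
      (sum_mul_betaK_le_of_le_one hα0 hα1 ht0 hmono hQ hQ0 hq hq1)
    rw [Finset.mem_Icc] at hj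
    exact mul_nonneg (hQ0 j hj.1 hj.2) (betaK_nonneg (by linarith)
      (ht0 ▸ le_of_mesh_lt hmono (Nat.zero_le _) hj.2))
  · exact sum_mul_betaK_le_of_one_le hα1 ht0 hmono hτ hQ hQ0 hn hq1

lemma mul_sum_mul_mittagLeffler_le (hα0 : 0 < α) (hα1 : α < 1) (ht0 : t 0 = 0)
    (hmono : ∀ i j : ℕ, i < j → j ≤ n → t i < t j)
    (hτ : ∀ k : ℕ, 2 ≤ k → k ≤ n → t (k - 1) - t (k - 2) ≤ t k - t (k - 1))
    (hQ : IsComplementaryKernel n (l1Weight α t) Q)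
    (hQ0 : ∀ j, 1 ≤ j → j ≤ n → 0 ≤ Q j) (hn : 1 ≤ n) {μ : ℝ} (hμ : 0 ≤ μ) :
    μ * ∑ j ∈ Finset.Icc 1 (n - 1), Q j * mittagLeffler α (μ * t j ^ α) ≤
      mittagLeffler α (μ * t n ^ α) - 1 := by
  have ht : ∀ k, k ≤ n → 0 ≤ t k := fun k hk => ht0 ▸ le_of_mesh_lt hmono (Nat.zero_le _) hk
  have h1 : HasSum (fun m : ℕ => μ * ∑ j ∈ Finset.Icc 1 (n - 1),
      Q j * (μ ^ m * betaK (1 + m * α) (t j)))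
      (μ * ∑ j ∈ Finset.Icc 1 (n - 1), Q j * mittagLeffler α (μ * t j ^ α)) := by
    refine (hasSum_sum fun j hj => ?_).mul_left μ
    rw [Finset.mem_Icc] at hj
    exact (hasSum_mittagLeffler hα0 μ (ht j (by omega))).mul_left (Q j)
  refine hasSum_le (fun m => ?_) h1 (hasSum_mul_mittagLeffler_sub_one hα0 μ (ht n le_rfl))
  have hm : α ≤ (m + 1 : ℕ) * α := by
    push_cast
    nlinarith [mul_nonneg (Nat.cast_nonneg (α := ℝ) m) hα0.le]
  have h := sum_mul_betaK_le hα0 hα1 ht0 hmono hτ hQ hQ0 hn (hα0.trans_le hm)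
  rw [add_comm _ (1 : ℝ)] at h
  rw [show 1 - α + (m + 1 : ℕ) * α = 1 + m * α by push_cast; ring] at h
  calc μ * ∑ j ∈ Finset.Icc 1 (n - 1), Q j * (μ ^ m * betaK (1 + m * α) (t j))
      = μ ^ (m + 1) * ∑ j ∈ Finset.Icc 1 (n - 1), Q j * betaK (1 + m * α) (t j) := by
        rw [Finset.mul_sum, Finset.mul_sum]
        exact Finset.sum_congr rfl fun j _ => by ring
    _ ≤ _ := mul_le_mul_of_nonneg_left h (pow_nonneg hμ _)

end Mesh

lemma sum_Icc_one_sub_le_of_sum_range_le {lam : ℕ → ℝ} (hlam : ∀ l, 0 ≤ lam l) {N j : ℕ} {L : ℝ}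
    (hL : ∑ l ∈ Finset.range N, lam l ≤ L) (hj : j ≤ N) :
    ∑ l ∈ Finset.Icc 1 j, lam (j - l) ≤ L := by
  have e : ∑ l ∈ Finset.Icc 1 j, lam (j - l) = ∑ l ∈ Finset.range j, lam l := by
    rw [sum_Icc_one_eq_sum_range, ← Finset.sum_range_reflect]
    refine Finset.sum_congr rfl fun l hl => ?_
    rw [Finset.mem_range] at hl
    congr 1
    omega
  rw [e]
  exact (Finset.sum_le_sum_of_subset_of_nonneg (Finset.range_mono hj)
    fun l _ _ => hlam l).trans hL

/-- Linearisation of the quadratic inequality at an index where `v` attains its maximum. -/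
lemma le_add_sum_of_sq_le {n : ℕ} {A : ℕ → ℕ → ℝ} {Q lam v η : ℕ → ℝ}
    (hQ : IsComplementaryKernel n A Q)
    (hA : ∀ j k, 1 ≤ k → k ≤ j → j ≤ n → 0 < A j k)
    (hQ0 : ∀ j, 1 ≤ j → j ≤ n → 0 ≤ Q j) (hlam : ∀ l, 0 ≤ lam l) (hv : ∀ j, 0 ≤ v j)
    (hη : ∀ j, 0 ≤ η j) (hmax : ∀ j, j ≤ n → v j ≤ v n)
    (h : ∀ j, 1 ≤ j → j ≤ n → ∑ k ∈ Finset.Icc 1 j, A j k * (v k ^ 2 - v (k - 1) ^ 2) ≤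
      ∑ l ∈ Finset.Icc 1 j, lam (j - l) * v l ^ 2 + v j * η j) :
    v n ≤ v 0 + ∑ j ∈ Finset.Icc 1 n, Q j * ∑ l ∈ Finset.Icc 1 j, lam (j - l) * v l +
      ∑ j ∈ Finset.Icc 1 n, Q j * η j := by
  have hsq : v n ^ 2 - v 0 ^ 2 ≤
      (∑ j ∈ Finset.Icc 1 n, Q j * ∑ l ∈ Finset.Icc 1 j, lam (j - l) * v l +
        ∑ j ∈ Finset.Icc 1 n, Q j * η j) * v n := by
    rw [← sum_Icc_one_sub (fun k => v k ^ 2) n, ← hQ.sum_mul_sum hA, ← Finset.sum_add_distrib,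
      Finset.sum_mul]
    refine Finset.sum_le_sum fun j hj => ?_
    rw [Finset.mem_Icc] at hj
    rw [← mul_add, mul_assoc]
    refine mul_le_mul_of_nonneg_left ((h j hj.1 hj.2).trans ?_) (hQ0 j hj.1 hj.2)
    rw [add_mul, Finset.sum_mul, mul_comm (v j)]
    refine add_le_add (Finset.sum_le_sum fun l hl => ?_)
      (mul_le_mul_of_nonneg_left (hmax j hj.2) (hη j))
    have hl' := (Finset.mem_Icc.1 hl).2
    rw [sq, ← mul_assoc]
    exact mul_le_mul_of_nonneg_left (hmax l (hl'.trans hj.2)) (mul_nonneg (hlam _) (hv l))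
  have h0 : v 0 ^ 2 ≤ v 0 * v n := by
    rw [sq]
    exact mul_le_mul_of_nonneg_left (hmax 0 (Nat.zero_le n)) (hv 0)
  have hS : 0 ≤ ∑ j ∈ Finset.Icc 1 n, Q j * ∑ l ∈ Finset.Icc 1 j, lam (j - l) * v l :=
    Finset.sum_nonneg fun j hj => mul_nonneg
      (hQ0 j (Finset.mem_Icc.1 hj).1 (Finset.mem_Icc.1 hj).2)
      (Finset.sum_nonneg fun l _ => mul_nonneg (hlam _) (hv l))
  have hS' : 0 ≤ ∑ j ∈ Finset.Icc 1 n, Q j * η j :=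
    Finset.sum_nonneg fun j hj => mul_nonneg
      (hQ0 j (Finset.mem_Icc.1 hj).1 (Finset.mem_Icc.1 hj).2) (hη j)
  rcases (hv n).eq_or_lt with h0' | hpos
  · rw [← h0']
    have := hv 0
    linarith
  · refine le_of_mul_le_mul_right ?_ hpos
    nlinarith

end Auxiliary

/-- Discrete fractional Grönwall inequality on a nonuniform mesh. -/
theorem stmt_5 (T : ℝ) (N : ℕ) (hN : 1 ≤ N) (t : ℕ → ℝ) (α : ℝ)
    (hα0 : 0 < α) (hα1 : α < 1)
    (ht0 : t 0 = 0) (htNT : t N ≤ T) (hT : 0 < T)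
    (hmono : ∀ i j : ℕ, i < j → j ≤ N → t i < t j)
    (hτmono : ∀ n : ℕ, 2 ≤ n → n ≤ N → t (n - 1) - t (n - 2) ≤ t n - t (n - 1))
    (a : ℕ → ℕ → ℝ)
    (ha : ∀ n k : ℕ, 1 ≤ k → k ≤ n → n ≤ N →
      a n (n - k) =
        (betaK (2 - α) (t n - t (k - 1)) - betaK (2 - α) (t n - t k)) / (t k - t (k - 1)))
    (P : ℕ → ℕ → ℝ)
    (hP0 : ∀ n : ℕ, 1 ≤ n → n ≤ N → P n 0 = 1 / a n 0)
    (hPrec : ∀ n k : ℕ, 1 ≤ k → k + 1 ≤ n → n ≤ N →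
      P n (n - k) = (1 / a k 0) *
        ∑ j ∈ Finset.Icc (k + 1) n, (a j (j - k - 1) - a j (j - k)) * P n (n - j))
    (lam : ℕ → ℝ) (hlam : ∀ l : ℕ, 0 ≤ lam l)
    (lamStar : ℝ)
    (hlamSum : ∑ l ∈ Finset.range N, lam l ≤ lamStar)
    (hτN : t N - t (N - 1) ≤ (2 * Real.Gamma (2 - α) * lamStar) ^ (-(1 / α)))
    (v ξ ϑ : ℕ → ℝ)
    (hv : ∀ n : ℕ, 0 ≤ v n) (hξ : ∀ n : ℕ, 0 ≤ ξ n) (hϑ : ∀ n : ℕ, 0 ≤ ϑ n)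
    (hmain : ∀ n : ℕ, 1 ≤ n → n ≤ N →
      ∑ k ∈ Finset.Icc 1 n, a n (n - k) * ((v k) ^ 2 - (v (k - 1)) ^ 2) ≤
        ∑ l ∈ Finset.Icc 1 n, lam (n - l) * (v l) ^ 2 + v n * (ξ n + ϑ n)) :
    ∀ n : ℕ, ∀ hn : 1 ≤ n, n ≤ N →
      v n ≤ 2 * mittagLeffler α (2 * lamStar * (t n) ^ α) *
        (v 0 +
          (Finset.Icc 1 n).sup' (Finset.nonempty_Icc.mpr hn)
            (fun j => ∑ l ∈ Finset.Icc 1 j, P j (j - l) * ξ l) +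
          betaK (1 + α) (t n) *
            (Finset.Icc 1 n).sup' (Finset.nonempty_Icc.mpr hn) (fun j => ϑ j)) := by
  have hlamStar0 : 0 ≤ lamStar := (Finset.sum_nonneg fun l _ => hlam l).trans hlamSum
  have hτN0 : 0 < t N - t (N - 1) := sub_pos.2 (hmono _ _ (by omega) le_rfl)
  have hΓ : 0 < Real.Gamma (2 - α) := Real.Gamma_pos_of_pos (by linarith)
  have hlamStar : 0 < lamStar := by
    refine hlamStar0.lt_of_ne' fun h => ?_
    rw [h, mul_zero, Real.zero_rpow (neg_ne_zero.2 (one_div_pos.2 hα0).ne')] at hτN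
    linarith
  have hmono' : ∀ n, n ≤ N → ∀ i j : ℕ, i < j → j ≤ n → t i < t j := fun n hn i j hij hj =>
    hmono i j hij (hj.trans hn)
  have hτle : ∀ n, 1 ≤ n → n ≤ N → t n - t (n - 1) ≤ t N - t (N - 1) := by
    intro n hn hnN
    induction hnN using Nat.decreasingInduction with
    | self => exact le_rfl
    | of_succ k hk ih => exact (hτmono (k + 1) (by omega) hk).trans (ih (by omega))
  have hPQ : ∀ n, 1 ≤ n → n ≤ N →
      IsComplementaryKernel n (l1Weight α t) (fun k => P n (n - k)) := by
    intro n hn hnN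
    have haw : ∀ j k, 1 ≤ k → k ≤ j → j ≤ N → a j (j - k) = l1Weight α t j k := ha
    refine ⟨?_, fun k hk hkn => ?_⟩
    · have := haw n n hn le_rfl hnN
      rw [Nat.sub_self] at this
      simp only [Nat.sub_self]
      rw [hP0 n hn hnN, this]
    · have := haw k k hk le_rfl (by omega)
      rw [Nat.sub_self] at this
      rw [hPrec n k hk hkn hnN, this]
      congr 1
      refine Finset.sum_congr rfl fun j hj => ?_
      rw [Finset.mem_Icc] at hj
      rw [Nat.sub_sub, haw j (k + 1) (by omega) hj.1 (by omega), haw j k hk (by omega) (by omega)]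
  have hA : ∀ n, n ≤ N → ∀ j k, 1 ≤ k → k ≤ j → j ≤ n → 0 < l1Weight α t j k :=
    fun n hn j k h1 h2 h3 => l1Weight_pos hα1 (hmono' j (h3.trans hn)) h1 h2
  have hQ0 : ∀ n, n ≤ N → ∀ j, 1 ≤ j → j ≤ n → 0 ≤ P n (n - j) := fun n hn j hj hjn =>
    (hPQ n (hj.trans hjn) hn).nonneg (hA n hn)
      (fun j k h1 h2 h3 => l1Weight_le_succ hα0 hα1 (hmono' j (h3.trans hn)) h1 h2) hj hjn
  have hP0le : ∀ n, 1 ≤ n → n ≤ N → P n 0 * lamStar ≤ 1 / 2 := by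
    intro n hn hnN
    have h := (hPQ n hn hnN).top
    rw [one_div_l1Weight_self hα1 (hmono _ _ (by omega) hnN)] at h
    simp only [Nat.sub_self] at h
    have h0 : 0 ≤ t n - t (n - 1) := (sub_pos.2 (hmono (n - 1) n (by omega) hnN)).le
    have hM : 0 < 2 * Real.Gamma (2 - α) * lamStar := by positivity
    have h1 := Real.rpow_le_rpow h0 ((hτle n hn hnN).trans hτN) hα0.le
    rw [← Real.rpow_mul hM.le, neg_mul, one_div_mul_cancel hα0.ne', Real.rpow_neg_one,
      ← one_div, le_div_iff₀ hM] at h1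
    rw [h]
    linarith
  have ht : ∀ n, n ≤ N → 0 ≤ t n := fun n hn =>
    ht0 ▸ le_of_mesh_lt (hmono' n hn) (Nat.zero_le n) le_rfl
  have hz : ∀ n, n ≤ N → 0 ≤ 2 * lamStar * t n ^ α := fun n hn =>
    mul_nonneg (by positivity) (Real.rpow_nonneg (ht n hn) _)
  intro n
  induction n using Nat.strong_induction_on with
  | _ n ih =>
  intro hn hnN
  set E : ℕ → ℝ := fun j => mittagLeffler α (2 * lamStar * t j ^ α) with hE
  set X : ℝ := (Finset.Icc 1 n).sup' (Finset.nonempty_Icc.mpr hn)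
    (fun j => ∑ l ∈ Finset.Icc 1 j, P j (j - l) * ξ l) with hX
  set Y : ℝ := (Finset.Icc 1 n).sup' (Finset.nonempty_Icc.mpr hn) (fun j => ϑ j) with hY
  set G : ℝ := v 0 + X + betaK (1 + α) (t n) * Y with hG
  have hXle : ∀ j, 1 ≤ j → j ≤ n → ∑ l ∈ Finset.Icc 1 j, P j (j - l) * ξ l ≤ X := fun j h1 h2 =>
    Finset.le_sup' (fun j => ∑ l ∈ Finset.Icc 1 j, P j (j - l) * ξ l) (Finset.mem_Icc.2 ⟨h1, h2⟩)
  have hYle : ∀ j, 1 ≤ j → j ≤ n → ϑ j ≤ Y := fun j h1 h2 =>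
    Finset.le_sup' ϑ (Finset.mem_Icc.2 ⟨h1, h2⟩)
  have hX0 : 0 ≤ X := (Finset.sum_nonneg fun l hl => mul_nonneg
    (hQ0 n hnN l (Finset.mem_Icc.1 hl).1 (Finset.mem_Icc.1 hl).2) (hξ l)).trans (hXle n hn le_rfl)
  have hY0 : 0 ≤ Y := (hϑ n).trans (hYle n hn le_rfl)
  have hβ0 : 0 ≤ betaK (1 + α) (t n) := betaK_nonneg (by linarith) (ht n hnN)
  have hv0G : v 0 ≤ G := by
    have := mul_nonneg hβ0 hY0
    linarith
  have hG0 : 0 ≤ G := (hv 0).trans hv0G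
  have hE1 : ∀ j, j ≤ N → 1 ≤ E j := fun j hj => one_le_mittagLeffler hα0 (hz j hj)
  have hEmono : ∀ j, j ≤ n → E j ≤ E n := fun j hj =>
    mittagLeffler_mono hα0 (hz j (hj.trans hnN)) (mul_le_mul_of_nonneg_left
      (Real.rpow_le_rpow (ht j (hj.trans hnN)) (le_of_mesh_lt (hmono' n hnN) hj le_rfl) hα0.le)
      (by positivity))
  have hprev : ∀ j, 1 ≤ j → j < n → v j ≤ 2 * E j * G := by
    intro j hj hjn
    refine (ih j hjn hj (by omega)).trans (mul_le_mul_of_nonneg_left ?_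
      (by have := hE1 j (by omega); linarith))
    have hsub : Finset.Icc 1 j ⊆ Finset.Icc 1 n := Finset.Icc_subset_Icc_right hjn.le
    refine add_le_add (add_le_add_right (Finset.sup'_mono _ hsub _) _)
      (mul_le_mul (betaK_le_betaK (by linarith) (ht j (by omega))
        (le_of_mesh_lt (hmono' n hnN) hjn.le le_rfl)) (Finset.sup'_mono _ hsub _)
        ((hϑ j).trans (Finset.le_sup' ϑ (Finset.mem_Icc.2 ⟨hj, le_rfl⟩))) hβ0)
  by_cases hmax : ∀ j, j ≤ n → v j ≤ v n
  swap
  · push Not at hmax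
    obtain ⟨j, hjn, hlt⟩ := hmax
    rcases Nat.eq_zero_or_pos j with rfl | hj
    · have := mul_le_mul_of_nonneg_right (hE1 n hnN) hG0
      nlinarith
    · have hjn' : j < n := hjn.lt_of_ne (by rintro rfl; exact lt_irrefl _ hlt)
      have := mul_le_mul_of_nonneg_right (hEmono j hjn) hG0
      have := hprev j hj hjn'
      linarith
  have hlin := le_add_sum_of_sq_le (hPQ n hn hnN) (hA n hnN) (hQ0 n hnN) hlam hv
    (fun j => add_nonneg (hξ j) (hϑ j)) hmax (fun j hj hjn => by
      refine le_trans (le_of_eq (Finset.sum_congr rfl fun k hk => ?_))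
        (hmain j hj (hjn.trans hnN))
      rw [Finset.mem_Icc] at hk
      rw [ha j k hk.1 hk.2 (hjn.trans hnN)]
      rfl)
  have hforce : ∑ j ∈ Finset.Icc 1 n, P n (n - j) * (ξ j + ϑ j) ≤
      X + betaK (1 + α) (t n) * Y := by
    simp only [mul_add]
    rw [Finset.sum_add_distrib]
    refine add_le_add (hXle n hn le_rfl) ?_
    have h := sum_mul_betaK_le_of_le_one hα0 hα1 ht0 (hmono' n hnN) (hPQ n hn hnN)
      (hQ0 n hnN) hα0 hα1.le
    simp only [sub_add_cancel, betaK_one, mul_one] at h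
    rw [add_comm α] at h
    refine le_trans ?_ (mul_le_mul_of_nonneg_right h hY0)
    rw [Finset.sum_mul]
    refine Finset.sum_le_sum fun j hj => ?_
    rw [Finset.mem_Icc] at hj
    exact mul_le_mul_of_nonneg_left (hYle j hj.1 hj.2) (hQ0 n hnN j hj.1 hj.2)
  have hsplit : ∑ j ∈ Finset.Icc 1 n, P n (n - j) * ∑ l ∈ Finset.Icc 1 j, lam (j - l) * v l =
      ∑ j ∈ Finset.Icc 1 (n - 1), P n (n - j) * ∑ l ∈ Finset.Icc 1 j, lam (j - l) * v l +
        P n 0 * ∑ l ∈ Finset.Icc 1 n, lam (n - l) * v l := by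
    obtain ⟨m, rfl⟩ : ∃ m, n = m + 1 := ⟨n - 1, by omega⟩
    rw [Finset.sum_Icc_succ_top (by omega), Nat.add_sub_cancel, Nat.sub_self]
  have hlast : P n 0 * ∑ l ∈ Finset.Icc 1 n, lam (n - l) * v l ≤ 1 / 2 * v n := by
    have hPn0 : 0 ≤ P n 0 := by simpa using hQ0 n hnN n hn le_rfl
    have h1 : ∑ l ∈ Finset.Icc 1 n, lam (n - l) * v l ≤ lamStar * v n := by
      refine le_trans (Finset.sum_le_sum fun l hl => mul_le_mul_of_nonneg_left
        (hmax l (Finset.mem_Icc.1 hl).2) (hlam _)) ?_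
      rw [← Finset.sum_mul]
      exact mul_le_mul_of_nonneg_right
        (sum_Icc_one_sub_le_of_sum_range_le hlam hlamSum hnN) (hv n)
    have h2 := mul_le_mul_of_nonneg_left h1 hPn0
    have h3 := mul_le_mul_of_nonneg_right (hP0le n hn hnN) (hv n)
    linarith
  have hfirst : ∑ j ∈ Finset.Icc 1 (n - 1), P n (n - j) *
      ∑ l ∈ Finset.Icc 1 j, lam (j - l) * v l ≤ (E n - 1) * G := by
    have h := mul_sum_mul_mittagLeffler_le hα0 hα1 ht0 (hmono' n hnN)
      (fun k h2 hk => hτmono k h2 (hk.trans hnN)) (hPQ n hn hnN) (hQ0 n hnN) hn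
      (μ := 2 * lamStar) (by positivity)
    refine le_trans ?_ (mul_le_mul_of_nonneg_right h hG0)
    rw [mul_assoc, Finset.sum_mul, Finset.mul_sum]
    refine Finset.sum_le_sum fun j hj => ?_
    rw [Finset.mem_Icc] at hj
    have hEj := hE1 j (by omega)
    have hb : ∑ l ∈ Finset.Icc 1 j, lam (j - l) * v l ≤ lamStar * (2 * E j * G) := by
      refine le_trans (Finset.sum_le_sum fun l hl => mul_le_mul_of_nonneg_left
        (?_ : v l ≤ 2 * E j * G) (hlam _)) ?_
      · rw [Finset.mem_Icc] at hl
        have hElj : E l ≤ E j := mittagLeffler_mono hα0 (hz l (by omega))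
          (mul_le_mul_of_nonneg_left (Real.rpow_le_rpow (ht l (by omega))
            (le_of_mesh_lt (hmono' n hnN) hl.2 (by omega)) hα0.le) (by positivity))
        have := mul_le_mul_of_nonneg_right hElj hG0
        have := hprev l hl.1 (by omega)
        linarith
      · rw [← Finset.sum_mul]
        exact mul_le_mul_of_nonneg_right
          (sum_Icc_one_sub_le_of_sum_range_le hlam hlamSum (by omega)) (by positivity)
    have h2 := mul_le_mul_of_nonneg_left hb (hQ0 n hnN j hj.1 (by omega))
    linarith
  rw [hsplit] at hlin
  linarith
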